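/- For every LTL formula φ, every U ⊆ el(φ), every formula Xψ ∈ el(φ), and every infinite word π ∈ L(A_φ^U): π ⊨ ψ if and only if Xψ ∈ U. -/

import Mathlib

open scoped ENNReal

/-- LTL formulas over atomic propositions `AP`. -/
inductive LTL (AP : Type) : Type
  | atom : AP → LTL AP
  | neg : LTL AP → LTL AP
  | conj : LTL AP → LTL AP → LTL AP
  | next : LTL AP → LTL AP
  | untl : LTL AP → LTL AP → LTL AP

namespace LTL

/-- Semantics of LTL over infinite words `w : ℕ → Set AP`. -/
def Sat {AP : Type} : (ℕ → Set AP) → LTL AP → Prop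
  | w, atom p => p ∈ w 0
  | w, neg φ => ¬ Sat w φ
  | w, conj φ ψ => Sat w φ ∧ Sat w ψ
  | w, next φ => Sat (fun i => w (i + 1)) φ
  | w, untl φ ψ =>
      ∃ j : ℕ, Sat (fun i => w (i + j)) ψ ∧ ∀ i < j, Sat (fun k => w (k + i)) φ

/-- `Subf ψ φ` : `ψ` is a subformula of `φ`. -/
inductive Subf {AP : Type} : LTL AP → LTL AP → Prop
  | refl (φ : LTL AP) : Subf φ φ
  | negI {ψ φ : LTL AP} : Subf ψ φ → Subf ψ (neg φ)
  | conjL {ψ φ₁ φ₂ : LTL AP} : Subf ψ φ₁ → Subf ψ (conj φ₁ φ₂)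
  | conjR {ψ φ₁ φ₂ : LTL AP} : Subf ψ φ₂ → Subf ψ (conj φ₁ φ₂)
  | nextI {ψ φ : LTL AP} : Subf ψ φ → Subf ψ (next φ)
  | untlL {ψ φ₁ φ₂ : LTL AP} : Subf ψ φ₁ → Subf ψ (untl φ₁ φ₂)
  | untlR {ψ φ₁ φ₂ : LTL AP} : Subf ψ φ₂ → Subf ψ (untl φ₁ φ₂)

/-- Elementary formulas `el φ`. -/
def el {AP : Type} : LTL AP → Set (LTL AP)
  | atom _ => ∅
  | neg ψ => el ψ
  | conj φ ψ => el φ ∪ el ψ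
  | next ψ => insert (next ψ) (el ψ)
  | untl φ ψ => insert (next (untl φ ψ)) (el φ ∪ el ψ)

/-- The satisfaction relation `(V, a) ⊩ ψ`. -/
def sd {AP : Type} (V : Set (LTL AP)) (a : Set AP) : LTL AP → Prop
  | atom p => p ∈ a
  | neg ψ => ¬ sd V a ψ
  | conj φ ψ => sd V a φ ∧ sd V a ψ
  | next ψ => next ψ ∈ V
  | untl φ ψ => sd V a ψ ∨ (sd V a φ ∧ next (untl φ ψ) ∈ V)

end LTL

/-- A generalized Büchi automaton with alphabet `Al` and state space `Q`. -/
structure GBA (Al : Type) (Q : Type) where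
  T : Q → Al → Set Q
  init : Set Q
  acc : Set (Set (Q × Al × Q))

namespace GBA

variable {Al Q : Type}

/-- A run of the automaton over the word `w`. -/
def IsRun (Au : GBA Al Q) (w : ℕ → Al) (ρ : ℕ → Q) : Prop :=
  ρ 0 ∈ Au.init ∧ ∀ i, ρ (i + 1) ∈ Au.T (ρ i) (w i)

/-- An accepting run: for each accepting set, some transition in it occurs at
infinitely many positions. -/
def IsAcceptingRun (Au : GBA Al Q) (w : ℕ → Al) (ρ : ℕ → Q) : Prop :=
  Au.IsRun w ρ ∧ ∀ F ∈ Au.acc, {i : ℕ | (ρ i, w i, ρ (i + 1)) ∈ F}.Infinite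

/-- The language of the automaton. -/
def Lang (Au : GBA Al Q) : Set (ℕ → Al) :=
  {w | ∃ ρ : ℕ → Q, Au.IsAcceptingRun w ρ}

/-- The automaton `Au` with single initial state `q`. -/
def from1 (Au : GBA Al Q) (q : Q) : GBA Al Q :=
  { Au with init := {q} }

/-- The language of the automaton started in state `q`. -/
def LangFrom (Au : GBA Al Q) (q : Q) : Set (ℕ → Al) :=
  (Au.from1 q).Lang

/-- Separated automaton: distinct states recognize disjoint languages. -/
def Separated (Au : GBA Al Q) : Prop :=
  ∀ q q' : Q, q ≠ q' → Au.LangFrom q ∩ Au.LangFrom q' = ∅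

/-- Reverse determinism: every state has exactly one `a`-predecessor for each letter `a`. -/
def RevDet (Au : GBA Al Q) : Prop :=
  ∀ (q' : Q) (a : Al), ∃! q : Q, q' ∈ Au.T q a

/-- Fully partitioned automaton: separated, every word is accepted from some
state, and reverse deterministic. -/
def FullyPartitioned (Au : GBA Al Q) : Prop :=
  Au.Separated ∧ (∀ w : ℕ → Al, ∃ q : Q, w ∈ Au.LangFrom q) ∧ Au.RevDet

/-- A state is reenterable if it has some predecessor. -/
def Reenterable (Au : GBA Al Q) (q : Q) : Prop :=
  ∃ (p : Q) (a : Al), q ∈ Au.T p a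

/-- The restriction of an automaton to its reenterable states, all of them initial. -/
def restrict (Au : GBA Al Q) : GBA Al {q : Q // Au.Reenterable q} where
  T q a := {q' | q'.1 ∈ Au.T q.1 a}
  init := Set.univ
  acc := (fun F => {t : {q : Q // Au.Reenterable q} × Al × {q : Q // Au.Reenterable q} |
            (t.1.1, t.2.1, t.2.2.1) ∈ F}) '' Au.acc

/-- Almost fully partitioned: the restriction to reenterable states is fully partitioned. -/
def AlmostFullyPartitioned (Au : GBA Al Q) : Prop :=
  Au.restrict.FullyPartitioned

end GBA

/-- The transition function of the automaton `A_φ`; the state `none` is the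
initial state `φ`, the state `some V` is the subset state `V ⊆ el φ`. -/
def autT {AP : Type} (φ : LTL AP) :
    Option (Set (LTL AP)) → Set AP → Set (Option (Set (LTL AP)))
  | none, a => {q' | ∃ V : Set (LTL AP), q' = some V ∧ V ⊆ φ.el ∧ LTL.sd V a φ}
  | some V, a => {q' | ∃ U : Set (LTL AP), q' = some U ∧ U ⊆ φ.el ∧
      ∀ ψ : LTL AP, LTL.next ψ ∈ φ.el → (LTL.next ψ ∈ V ↔ LTL.sd U a ψ)}

/-- The generalized Büchi automaton `A_φ` of an LTL formula `φ`. -/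
def aut {AP : Type} (φ : LTL AP) : GBA (Set AP) (Option (Set (LTL AP))) where
  T := autT φ
  init := {none}
  acc := {F | ∃ φ₁ φ₂ : LTL AP, LTL.Subf (LTL.untl φ₁ φ₂) φ ∧
    F = {t : Option (Set (LTL AP)) × Set AP × Option (Set (LTL AP)) |
          t.2.2 ∈ autT φ t.1 t.2.1 ∧
          ∃ V : Set (LTL AP), t.2.2 = some V ∧
            (LTL.sd V t.2.1 φ₂ ∨ ¬ LTL.sd V t.2.1 (LTL.untl φ₁ φ₂))}}

/-- The automaton `A_φ^U` for `U ⊆ el φ`. -/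
def autFrom {AP : Type} (φ : LTL AP) (U : Set (LTL AP)) :
    GBA (Set AP) (Option (Set (LTL AP))) :=
  (aut φ).from1 (some U)

/-- A (finite, labelled) Markov chain with state space `S` and labels in `Al`. -/
structure MC (S : Type) (Al : Type) where
  L : S → Al
  init : S
  P : S → S → ℝ≥0∞

namespace MC

variable {S Al : Type}

/-- The edge relation of the underlying graph of the Markov chain. -/
def E (M : MC S Al) : S → S → Prop := fun s s' => 0 < M.P s s'

/-- The labelled word generated by a path of the Markov chain. -/
def word (M : MC S Al) (π : ℕ → S) : ℕ → Al := fun i => M.L (π i)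

end MC

/-- The edge relation of the product graph `A × M`. -/
def prodE {S Al Q : Type} (Au : GBA Al Q) (M : MC S Al) : Q × S → Q × S → Prop :=
  fun v v' => M.E v.2 v'.2 ∧ v'.1 ∈ Au.T v.1 (M.L v.2)

/-- All vertices of `C` are mutually reachable. -/
def MutReach {V : Type} (E : V → V → Prop) (C : Set V) : Prop :=
  ∀ u ∈ C, ∀ v ∈ C, Relation.ReflTransGen E u v

/-- `C` is a (non-extensible, i.e. maximal) strongly connected component. -/
def IsSCC {V : Type} (E : V → V → Prop) (C : Set V) : Prop :=
  C.Nonempty ∧ MutReach E C ∧ ∀ C' : Set V, C ⊆ C' → MutReach E C' → C' = C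

/-- `SCCle E C C'` : some vertex of `C'` is reachable from some vertex of `C`. -/
def SCCle {V : Type} (E : V → V → Prop) (C C' : Set V) : Prop :=
  ∃ u ∈ C, ∃ v ∈ C', Relation.ReflTransGen E u v

/-- A bottom SCC: an SCC maximal with respect to reachability. -/
def IsBSCC {V : Type} (E : V → V → Prop) (C : Set V) : Prop :=
  IsSCC E C ∧ ∀ C' : Set V, IsSCC E C' → SCCle E C C' → C' = C

/-- A finite path of the graph `E` lying in the set `C`. -/
def FinPathIn {V : Type} (E : V → V → Prop) (C : Set V) (l : List V) : Prop :=
  l.Chain' E ∧ ∀ v ∈ l, v ∈ C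

/-- An infinite path of the graph `E` lying in the set `C`. -/
def InfPathIn {V : Type} (E : V → V → Prop) (C : Set V) (π : ℕ → V) : Prop :=
  (∀ i, E (π i) (π (i + 1))) ∧ ∀ i, π i ∈ C

/-- The infinite path `π` visits the finite path `l` infinitely often, i.e. `l`
occurs as a contiguous fragment starting at infinitely many positions of `π`. -/
def VisitsInfOften {V : Type} (π : ℕ → V) (l : List V) : Prop :=
  {n : ℕ | ∀ i : Fin l.length, π (n + i.1) = l.get i}.Infinite

/-- The projection `H(C)` of a set of product vertices to the Markov chain. -/
def Hproj {Q S : Type} (C : Set (Q × S)) : Set S := Prod.snd '' C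

/-- A complete SCC of the product graph: every finite path of `H(C)` is the
projection of some finite path in `C`. -/
def CompleteSCC {S Al Q : Type} (Au : GBA Al Q) (M : MC S Al) (C : Set (Q × S)) : Prop :=
  ∀ l : List S, FinPathIn M.E (Hproj C) l →
    ∃ σ : List (Q × S), FinPathIn (prodE Au M) C σ ∧ σ.map Prod.snd = l

/-- An accepting SCC of the product graph. -/
def AcceptingSCC {S Al Q : Type} (Au : GBA Al Q) (M : MC S Al) (C : Set (Q × S)) : Prop :=
  ∀ F ∈ Au.acc, ∃ v ∈ C, ∃ v' ∈ C, prodE Au M v v' ∧ (v.1, M.L v.2, v'.1) ∈ F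

/-- A locally positive SCC: accepting, complete, and `H(C)` is a bottom SCC of
the underlying graph of `M`. -/
def LocallyPositive {S Al Q : Type} (Au : GBA Al Q) (M : MC S Al) (C : Set (Q × S)) : Prop :=
  AcceptingSCC Au M C ∧ CompleteSCC Au M C ∧ IsBSCC M.E (Hproj C)

/-- The σ-algebra on `ℕ → S` generated by the cylinder sets. -/
def CylSigma (S : Type) : MeasurableSpace (ℕ → S) :=
  MeasurableSpace.generateFrom
    {A : Set (ℕ → S) | ∃ l : List S, A = {π | ∀ i : Fin l.length, π i.1 = l.get i}}

/-- `μ` is the path measure of the Markov chain with transition matrix `P` and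
initial state `s`: the measure of each cylinder is the product of the transition
probabilities along it. -/
def IsPathMeasure {S : Type} [DecidableEq S] (P : S → S → ℝ≥0∞) (s : S)
    (μ : @MeasureTheory.Measure (ℕ → S) (CylSigma S)) : Prop :=
  ∀ (k : ℕ) (f : ℕ → S),
    μ {π | ∀ i ≤ k, π i = f i} =
      (if f 0 = s then 1 else 0) * ∏ i ∈ Finset.range k, P (f i) (f (i + 1))

namespace LTL

variable {AP : Type}

theorem Subf.trans {χ ψ φ : LTL AP} (h₁ : Subf χ ψ) (h₂ : Subf ψ φ) : Subf χ φ := by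
  induction h₂ with
  | refl => exact h₁
  | negI _ ih => exact .negI ih
  | conjL _ ih => exact .conjL ih
  | conjR _ ih => exact .conjR ih
  | nextI _ ih => exact .nextI ih
  | untlL _ ih => exact .untlL ih
  | untlR _ ih => exact .untlR ih

theorem Subf.el_subset {ψ φ : LTL AP} (h : Subf ψ φ) : ψ.el ⊆ φ.el := by
  induction h with
  | refl => exact subset_rfl
  | negI _ ih => exact ih
  | conjL _ ih => exact ih.trans Set.subset_union_left
  | conjR _ ih => exact ih.trans Set.subset_union_right
  | nextI _ ih => exact ih.trans (Set.subset_insert _ _)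
  | untlL _ ih => exact (ih.trans Set.subset_union_left).trans (Set.subset_insert _ _)
  | untlR _ ih => exact (ih.trans Set.subset_union_right).trans (Set.subset_insert _ _)

theorem subf_of_next_mem_el {ψ φ : LTL AP} (h : next ψ ∈ φ.el) : Subf ψ φ := by
  induction φ with
  | atom p => exact h.elim
  | neg φ ih => exact .negI (ih h)
  | conj φ₁ φ₂ ih₁ ih₂ => exact h.elim (fun h => .conjL (ih₁ h)) fun h => .conjR (ih₂ h)
  | next φ ih =>
    rcases h with h | h
    · cases h
      exact .nextI (.refl _)
    · exact .nextI (ih h)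
  | untl φ₁ φ₂ ih₁ ih₂ =>
    rcases h with h | h | h
    · cases h
      exact .refl _
    · exact .untlL (ih₁ h)
    · exact .untlR (ih₂ h)

/-- A predicate that unfolds like an until and is fulfilled or false infinitely often
coincides with the until. -/
theorem until_iff_of_expansion {p q r : ℕ → Prop}
    (hr : ∀ i, r i ↔ q i ∨ (p i ∧ r (i + 1)))
    (hinf : {i | q i ∨ ¬ r i}.Infinite) (i : ℕ) :
    r i ↔ ∃ j, q (j + i) ∧ ∀ k < j, p (k + i) := by
  constructor
  · intro hi
    obtain ⟨n, hn, hin⟩ := hinf.exists_gt i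
    obtain ⟨d, rfl⟩ := Nat.exists_eq_add_of_lt hin
    clear hin
    suffices ∀ d i, r i → (q (i + d) ∨ ¬ r (i + d)) →
        ∃ j, q (j + i) ∧ ∀ k < j, p (k + i) from this (d + 1) i hi hn
    intro d
    induction d with
    | zero =>
      intro i hi hd
      exact ⟨0, by simpa using hd.resolve_right (not_not_intro hi), by simp⟩
    | succ d ih =>
      intro i hi hd
      rcases (hr i).1 hi with hq | ⟨hp, hi'⟩
      · exact ⟨0, by simpa using hq, by simp⟩
      · obtain ⟨j, hq, hj⟩ := ih (i + 1) hi' (by rwa [Nat.add_right_comm i 1 d])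
        refine ⟨j + 1, by rwa [Nat.add_right_comm j 1 i], ?_⟩
        rintro (_ | k) hk
        · simpa using hp
        · rw [Nat.add_right_comm k 1 i]
          exact hj k (by omega)
  · rintro ⟨j, hq, hp⟩
    induction j generalizing i with
    | zero => exact (hr i).2 (.inl (by simpa using hq))
    | succ j ih =>
      refine (hr i).2 (.inr ⟨by simpa using hp 0 (by omega), ih (i + 1) ?_ ?_⟩)
      · rwa [Nat.add_right_comm] at hq
      · intro k hk
        have := hp (k + 1) (by omega)
        rwa [Nat.add_right_comm] at this

/-- Along an accepting run through the subset states `V`, the relation `⊩` describes the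
semantics of every subformula of `φ`. -/
theorem sd_iff_sat {φ : LTL AP} {w : ℕ → Set AP} {V : ℕ → Set (LTL AP)}
    (hT : ∀ i ψ, next ψ ∈ φ.el → (next ψ ∈ V i ↔ sd (V (i + 1)) (w i) ψ))
    (hacc : ∀ φ₁ φ₂, Subf (untl φ₁ φ₂) φ →
      {i | sd (V (i + 1)) (w i) φ₂ ∨ ¬ sd (V (i + 1)) (w i) (untl φ₁ φ₂)}.Infinite)
    {χ : LTL AP} (hχ : Subf χ φ) (i : ℕ) :
    sd (V (i + 1)) (w i) χ ↔ Sat (fun k => w (k + i)) χ := by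
  induction χ generalizing i with
  | atom p => simp [sd, Sat]
  | neg χ ih => simp only [sd, Sat, ih (.trans (.negI (.refl _)) hχ)]
  | conj χ₁ χ₂ ih₁ ih₂ =>
    simp only [sd, Sat, ih₁ (.trans (.conjL (.refl _)) hχ), ih₂ (.trans (.conjR (.refl _)) hχ)]
  | next χ ih =>
    rw [sd, hT _ _ (hχ.el_subset (Set.mem_insert _ _)), ih (.trans (.nextI (.refl _)) hχ), Sat]
    simp only [Nat.add_right_comm _ 1 i, Nat.add_assoc]
  | untl χ₁ χ₂ ih₁ ih₂ =>
    rw [until_iff_of_expansion (p := fun i => sd (V (i + 1)) (w i) χ₁)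
      (q := fun i => sd (V (i + 1)) (w i) χ₂)
      (r := fun i => sd (V (i + 1)) (w i) (untl χ₁ χ₂)) ?_ (hacc _ _ hχ) i]
    · simp only [Sat, ih₁ (.trans (.untlL (.refl _)) hχ), ih₂ (.trans (.untlR (.refl _)) hχ)]
      simp only [Nat.add_assoc]
    · intro i
      rw [sd, hT _ _ (hχ.el_subset (Set.mem_insert _ _))]

end LTL

theorem exists_subset_states_of_run {AP : Type} {φ : LTL AP} {U : Set (LTL AP)}
    {w : ℕ → Set AP} {ρ : ℕ → Option (Set (LTL AP))} (h : (autFrom φ U).IsRun w ρ) :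
    ∃ V : ℕ → Set (LTL AP), V 0 = U ∧ ∀ i, ρ i = some (V i) := by
  have hsome : ∀ i, ∃ V, ρ i = some V := by
    intro i
    induction i with
    | zero => exact ⟨U, h.1⟩
    | succ i ih =>
      obtain ⟨V, hV⟩ := ih
      have hi : ρ (i + 1) ∈ autT φ (ρ i) (w i) := h.2 i
      rw [hV] at hi
      obtain ⟨V', hV', -⟩ := hi
      exact ⟨V', hV'⟩
  choose V hV using hsome
  exact ⟨V, Option.some_injective _ ((hV 0).symm.trans h.1), hV⟩

/-- For every LTL formula `φ`, every `U ⊆ el φ`, every formula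
`X ψ ∈ el φ`, and every infinite word `π ∈ L(A_φ^U)`: `π ⊨ ψ` iff `X ψ ∈ U`. -/
theorem ltl_sat_iff_next_mem {AP : Type} [Fintype AP]
    (φ : LTL AP) (U : Set (LTL AP)) (hU : U ⊆ φ.el)
    (ψ : LTL AP) (hψ : LTL.next ψ ∈ φ.el)
    (π : ℕ → Set AP) (hπ : π ∈ (autFrom φ U).Lang) :
    LTL.Sat π ψ ↔ LTL.next ψ ∈ U := by
  obtain ⟨ρ, hrun, hacc⟩ := hπ
  obtain ⟨V, rfl, hV⟩ := exists_subset_states_of_run hrun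
  have hT : ∀ i ψ, LTL.next ψ ∈ φ.el →
      (LTL.next ψ ∈ V i ↔ LTL.sd (V (i + 1)) (π i) ψ) := by
    intro i
    have hi : ρ (i + 1) ∈ autT φ (ρ i) (π i) := hrun.2 i
    rw [hV, hV] at hi
    obtain ⟨V', hV', -, h⟩ := hi
    cases hV'
    exact h
  have hinf : ∀ φ₁ φ₂, LTL.Subf (LTL.untl φ₁ φ₂) φ →
      {i | LTL.sd (V (i + 1)) (π i) φ₂ ∨
        ¬ LTL.sd (V (i + 1)) (π i) (LTL.untl φ₁ φ₂)}.Infinite := by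
    intro φ₁ φ₂ hsub
    refine (hacc _ ⟨φ₁, φ₂, hsub, rfl⟩).mono ?_
    rintro i ⟨-, V', hV', h⟩
    cases (hV (i + 1)).symm.trans hV'
    exact h
  rw [hT 0 ψ hψ]
  exact (LTL.sd_iff_sat hT hinf (LTL.subf_of_next_mem_el hψ) 0).symm
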